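/- Let f = (f11,f12,f22) be a symmetric 2-tensor field with C² components compactly supported in the open unit disk. Then for every x ∈ ℝ², f12(x) = (1/(4·u1²))·∂/∂x2( X_{e1}[ D_u D_v (L¹f) + D_u(Lf) + D_v(Lf) + (1/u2)·D_u D_v X_{e2}(Lf) ] )(x). -/

import Mathlib

open MeasureTheory

noncomputable section

/-- Rotation of a vector by 90 degrees: `w⊥ = (-w2, w1)`. -/
def perp (w : ℝ × ℝ) : ℝ × ℝ := (-w.2, w.1)

/-- Divergent beam transform `X_w h (x) = ∫_0^∞ h(x + t w) dt`. -/
def Xray (w : ℝ × ℝ) (h : ℝ × ℝ → ℝ) (x : ℝ × ℝ) : ℝ :=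
  ∫ t in Set.Ioi (0:ℝ), h (x + t • w)

/-- First moment divergent beam transform `X¹_w h (x) = ∫_0^∞ t·h(x + t w) dt`. -/
def Xray1 (w : ℝ × ℝ) (h : ℝ × ℝ → ℝ) (x : ℝ × ℝ) : ℝ :=
  ∫ t in Set.Ioi (0:ℝ), t * h (x + t • w)

/-- Directional derivative `D_w h = w1 ∂h/∂x1 + w2 ∂h/∂x2`. -/
def Dw (w : ℝ × ℝ) (h : ℝ × ℝ → ℝ) (x : ℝ × ℝ) : ℝ :=
  fderiv ℝ h x w

/-- Partial derivative in the first coordinate. -/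
def pdx (h : ℝ × ℝ → ℝ) : ℝ × ℝ → ℝ := Dw (1, 0) h

/-- Partial derivative in the second coordinate. -/
def pdy (h : ℝ × ℝ → ℝ) : ℝ × ℝ → ℝ := Dw (0, 1) h

/-- The open unit disk in ℝ². -/
def unitDisk : Set (ℝ × ℝ) := {x | x.1 ^ 2 + x.2 ^ 2 < 1}

/-- `⟨f, w²⟩ = f11 w1² + 2 f12 w1 w2 + f22 w2²`. -/
def proj2 (f11 f12 f22 : ℝ × ℝ → ℝ) (w : ℝ × ℝ) (x : ℝ × ℝ) : ℝ :=
  f11 x * w.1 ^ 2 + 2 * f12 x * w.1 * w.2 + f22 x * w.2 ^ 2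

/-- `⟨f, w ⊙ w⊥⟩ = -f11 w1 w2 + f12 (w1² - w2²) + f22 w1 w2`. -/
def projMix (f11 f12 f22 : ℝ × ℝ → ℝ) (w : ℝ × ℝ) (x : ℝ × ℝ) : ℝ :=
  -(f11 x) * w.1 * w.2 + f12 x * (w.1 ^ 2 - w.2 ^ 2) + f22 x * w.1 * w.2

/-- V-line transform of a scalar function. -/
def Vlt (u v : ℝ × ℝ) (h : ℝ × ℝ → ℝ) (x : ℝ × ℝ) : ℝ := Xray u h x + Xray v h x

/-- Longitudinal V-line transform. -/
def Lf (u v : ℝ × ℝ) (f11 f12 f22 : ℝ × ℝ → ℝ) (x : ℝ × ℝ) : ℝ :=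
  Xray u (proj2 f11 f12 f22 u) x + Xray v (proj2 f11 f12 f22 v) x

/-- Transverse V-line transform. -/
def Tf (u v : ℝ × ℝ) (f11 f12 f22 : ℝ × ℝ → ℝ) (x : ℝ × ℝ) : ℝ :=
  Xray u (proj2 f11 f12 f22 (perp u)) x + Xray v (proj2 f11 f12 f22 (perp v)) x

/-- Mixed V-line transform. -/
def Mf (u v : ℝ × ℝ) (f11 f12 f22 : ℝ × ℝ → ℝ) (x : ℝ × ℝ) : ℝ :=
  Xray u (projMix f11 f12 f22 u) x + Xray v (projMix f11 f12 f22 v) x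

/-- First moment longitudinal V-line transform. -/
def L1f (u v : ℝ × ℝ) (f11 f12 f22 : ℝ × ℝ → ℝ) (x : ℝ × ℝ) : ℝ :=
  Xray1 u (proj2 f11 f12 f22 u) x + Xray1 v (proj2 f11 f12 f22 v) x

/-- The weighted divergent beam transform `∫_0^∞ φ(t)·h(x + t w) dt`. -/
def weightedBeam (φ : ℝ → ℝ) (w : ℝ × ℝ) (h : ℝ × ℝ → ℝ) (x : ℝ × ℝ) : ℝ :=
  ∫ t in Set.Ioi (0:ℝ), φ t * h (x + t • w)

/-- The function `h` vanishes on the open half plane above height `c`. -/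
def VanishesAbove (c : ℝ) (h : ℝ × ℝ → ℝ) : Prop := ∀ x : ℝ × ℝ, c < x.2 → h x = 0

theorem Xray_eq_weightedBeam (w : ℝ × ℝ) (h : ℝ × ℝ → ℝ) :
    Xray w h = weightedBeam (fun _ => 1) w h := by
  funext x
  simp [Xray, weightedBeam]

theorem setIntegral_Ioi_eq_intervalIntegral {g : ℝ → ℝ} {T : ℝ} (hT : 0 ≤ T)
    (hg : ∀ t, T < t → g t = 0) : ∫ t in Set.Ioi (0:ℝ), g t = ∫ t in (0:ℝ)..T, g t := by
  rw [intervalIntegral.integral_of_le hT]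
  refine setIntegral_eq_of_subset_of_forall_sdiff_eq_zero measurableSet_Ioi
    (fun t ht => ht.1) fun t ht => hg t ?_
  by_contra! hle
  exact ht.2 ⟨ht.1, hle⟩

theorem integrableOn_Ioi_of_eq_zero {g : ℝ → ℝ} {T : ℝ} (hc : Continuous g)
    (hg : ∀ t, T < t → g t = 0) : IntegrableOn g (Set.Ioi 0) := by
  refine IntegrableOn.of_forall_sdiff_eq_zero (s := Set.Icc 0 T)
    hc.integrableOn_Icc measurableSet_Ioi fun t ht => hg t ?_
  by_contra! hle
  exact ht.2 ⟨le_of_lt ht.1, hle⟩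

theorem setIntegral_Ioi_deriv_eq_neg {g g' : ℝ → ℝ} {T : ℝ} (hd : ∀ t, HasDerivAt g (g' t) t)
    (hc : Continuous g') (hg : ∀ t, T < t → g t = 0) :
    ∫ t in Set.Ioi (0:ℝ), g' t = -g 0 := by
  have hg' : ∀ t, T < t → g' t = 0 := fun t ht => by
    have hz : g =ᶠ[nhds t] fun _ => (0:ℝ) := by
      filter_upwards [lt_mem_nhds ht] with s hs using hg s hs
    exact (hd t).unique ((hasDerivAt_const t (0:ℝ)).congr_of_eventuallyEq hz)
  have hlim : Filter.Tendsto g Filter.atTop (nhds 0) :=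
    tendsto_const_nhds.congr' (by
      filter_upwards [Filter.eventually_gt_atTop T] with s hs using (hg s hs).symm)
  rw [integral_Ioi_of_hasDerivAt_of_tendsto' (fun t _ => hd t)
    (integrableOn_Ioi_of_eq_zero hc hg') hlim, zero_sub]

theorem hasDerivAt_along_ray {h : ℝ × ℝ → ℝ} (hh : Differentiable ℝ h) (w x : ℝ × ℝ) (t : ℝ) :
    HasDerivAt (fun t : ℝ => h (x + t • w)) (Dw w h (x + t • w)) t := by
  have hl : HasDerivAt (fun t : ℝ => x + t • w) w t := by
    simpa using ((hasDerivAt_id t).smul_const w).const_add x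
  exact (hh (x + t • w)).hasFDerivAt.comp_hasDerivAt t hl

theorem continuous_Dw {h : ℝ × ℝ → ℝ} (hh : ContDiff ℝ 1 h) (w : ℝ × ℝ) : Continuous (Dw w h) :=
  (hh.continuous_fderiv one_ne_zero).clm_apply continuous_const

theorem contDiff_Dw {h : ℝ × ℝ → ℝ} (hh : ContDiff ℝ 2 h) (w : ℝ × ℝ) : ContDiff ℝ 1 (Dw w h) :=
  (hh.fderiv_right (m := 1) (by norm_num)).clm_apply contDiff_const

theorem Dw_eq_linearCombination (w : ℝ × ℝ) (h : ℝ × ℝ → ℝ) (x : ℝ × ℝ) :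
    Dw w h x = w.1 * Dw (1, 0) h x + w.2 * Dw (0, 1) h x := by
  have hw : w = w.1 • ((1:ℝ), (0:ℝ)) + w.2 • ((0:ℝ), (1:ℝ)) := by ext <;> simp
  conv_lhs => rw [Dw, hw, map_add, map_smul, map_smul]
  rfl

theorem Dw_add {g h : ℝ × ℝ → ℝ} (hg : Differentiable ℝ g) (hh : Differentiable ℝ h)
    (w x : ℝ × ℝ) : Dw w (fun y => g y + h y) x = Dw w g x + Dw w h x := by
  simp only [Dw, fderiv_fun_add (hg x) (hh x), add_apply]

theorem Dw_neg (h : ℝ × ℝ → ℝ) (w x : ℝ × ℝ) : Dw w (fun y => -h y) x = -Dw w h x := by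
  simp only [Dw, fderiv_fun_neg, neg_apply]

theorem Dw_const_mul (k : ℝ) (h : ℝ × ℝ → ℝ) (w x : ℝ × ℝ) :
    Dw w (fun y => k * h y) x = k * Dw w h x := by
  exact DFunLike.congr_fun (congrFun (fderiv_const_smul_field (𝕜 := ℝ) (f := h) k) x) w

theorem lt_snd_along_ray {c : ℝ} {w : ℝ × ℝ} (hw : 0 < w.2) {x : ℝ × ℝ} {t : ℝ}
    (ht : (|c| + |x.2|) / w.2 < t) : c < (x + t • w).2 := by
  rw [div_lt_iff₀ hw] at ht
  have h1 := le_abs_self c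
  have h2 := neg_abs_le x.2
  simp
  linarith

namespace VanishesAbove

variable {c : ℝ} {g h : ℝ × ℝ → ℝ}

theorem fderiv_eq_zero (hc : VanishesAbove c h) {x : ℝ × ℝ} (hx : c < x.2) :
    fderiv ℝ h x = 0 := by
  have hz : h =ᶠ[nhds x] fun _ => (0:ℝ) := by
    filter_upwards [(isOpen_lt continuous_const continuous_snd).mem_nhds hx] with y hy
      using hc y hy
  rw [hz.fderiv_eq, fderiv_fun_const, Pi.zero_apply]

theorem Dw (hc : VanishesAbove c h) (w : ℝ × ℝ) : VanishesAbove c (Dw w h) := fun x hx => by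
  simp [_root_.Dw, hc.fderiv_eq_zero hx]

theorem add (hg : VanishesAbove c g) (hh : VanishesAbove c h) :
    VanishesAbove c (fun x => g x + h x) := fun x hx => by
  simp [hg x hx, hh x hx]

theorem neg (hh : VanishesAbove c h) : VanishesAbove c (fun x => -h x) := fun x hx => by
  simp [hh x hx]

theorem const_mul (hh : VanishesAbove c h) (k : ℝ) :
    VanishesAbove c (fun x => k * h x) := fun x hx => by
  simp [hh x hx]

theorem Xray (hc : VanishesAbove c h) {w : ℝ × ℝ} (hw : 0 < w.2) :
    VanishesAbove c (Xray w h) := fun x hx => by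
  rw [_root_.Xray, setIntegral_congr_fun (g := fun _ => 0) measurableSet_Ioi fun t ht => ?_]
  · simp
  · have := mul_pos ht hw
    exact hc _ (by simp; linarith)

end VanishesAbove

section WeightedBeam

variable {c : ℝ} {φ : ℝ → ℝ} {w : ℝ × ℝ} {h : ℝ × ℝ → ℝ}

theorem weightedBeam_eq_intervalIntegral (hc : VanishesAbove c h) (hw : 0 < w.2) (x : ℝ × ℝ)
    {T : ℝ} (hT : (|c| + |x.2|) / w.2 ≤ T) :
    weightedBeam φ w h x = ∫ t in (0:ℝ)..T, φ t * h (x + t • w) :=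
  setIntegral_Ioi_eq_intervalIntegral (le_trans (by positivity) hT) fun t ht => by
    rw [hc _ (lt_snd_along_ray hw (hT.trans_lt ht)), mul_zero]

theorem continuous_weightedBeam (hφ : Continuous φ) (hw : 0 < w.2) (hh : Continuous h)
    (hc : VanishesAbove c h) : Continuous (weightedBeam φ w h) := by
  have he : weightedBeam φ w h =
      fun x => ∫ t in (0:ℝ)..((|c| + |x.2|) / w.2), φ t * h (x + t • w) :=
    funext fun x => weightedBeam_eq_intervalIntegral hc hw x le_rfl
  rw [he]
  refine intervalIntegral.continuous_parametric_intervalIntegral_of_continuous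
    (f := fun (x : ℝ × ℝ) t => φ t * h (x + t • w)) ?_ (by fun_prop)
  simp only [Function.uncurry_def]
  fun_prop

theorem hasFDerivAt_weightedBeam (hφ : Continuous φ) (hw : 0 < w.2) (hh : ContDiff ℝ 1 h)
    (hc : VanishesAbove c h) (x : ℝ × ℝ) :
    HasFDerivAt (weightedBeam φ w h)
      (∫ t in (0:ℝ)..((|c| + (|x.2| + 1)) / w.2), φ t • fderiv ℝ h (x + t • w)) x := by
  set T := (|c| + (|x.2| + 1)) / w.2 with hT
  have hfd : Continuous (fderiv ℝ h) := hh.continuous_fderiv one_ne_zero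
  have hd : Differentiable ℝ h := hh.differentiable one_ne_zero
  have hcont : Continuous h := hh.continuous
  have hloc : weightedBeam φ w h =ᶠ[nhds x] fun y => ∫ t in (0:ℝ)..T, φ t * h (y + t • w) := by
    have hopen : {y : ℝ × ℝ | |y.2| < |x.2| + 1} ∈ nhds x :=
      (isOpen_lt (by fun_prop) (by fun_prop)).mem_nhds (by simp)
    filter_upwards [hopen] with y hy
    refine weightedBeam_eq_intervalIntegral hc hw y ?_
    have hy' : |y.2| < |x.2| + 1 := hy
    rw [hT]
    gcongr
  refine HasFDerivAt.congr_of_eventuallyEq ?_ hloc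
  have hjoint : Continuous fun p : (ℝ × ℝ) × ℝ => φ p.2 • fderiv ℝ h (p.1 + p.2 • w) := by
    fun_prop
  obtain ⟨C, hC⟩ := ((isCompact_closedBall x 1).prod
    (isCompact_uIcc (a := (0:ℝ)) (b := T))).exists_bound_of_continuousOn hjoint.continuousOn
  refine intervalIntegral.hasFDerivAt_integral_of_dominated_of_fderiv_le (𝕜 := ℝ)
    (F' := fun y t => φ t • fderiv ℝ h (y + t • w)) (bound := fun _ => C)
    (Metric.closedBall_mem_nhds x one_pos) (.of_forall fun y => ?_) ?_ ?_
    (.of_forall fun t ht y hy => hC (y, t) ⟨hy, Set.uIoc_subset_uIcc ht⟩)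
    intervalIntegrable_const (.of_forall fun t _ y _ => ?_)
  · exact Continuous.aestronglyMeasurable (by fun_prop)
  · exact Continuous.intervalIntegrable (by fun_prop) _ _
  · exact Continuous.aestronglyMeasurable (by fun_prop)
  · exact ((hasFDerivAt_comp_add_right _).2 (hd (y + t • w)).hasFDerivAt).const_mul (φ t)

theorem Dw_weightedBeam (hφ : Continuous φ) (hw : 0 < w.2) (hh : ContDiff ℝ 1 h)
    (hc : VanishesAbove c h) (v : ℝ × ℝ) :
    Dw v (weightedBeam φ w h) = weightedBeam φ w (Dw v h) := by
  funext x
  have hfd : Continuous (fderiv ℝ h) := hh.continuous_fderiv one_ne_zero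
  have hle : (|c| + |x.2|) / w.2 ≤ (|c| + (|x.2| + 1)) / w.2 := by
    gcongr
    linarith
  rw [Dw, (hasFDerivAt_weightedBeam hφ hw hh hc x).fderiv,
    weightedBeam_eq_intervalIntegral (hc.Dw v) hw x hle,
    ContinuousLinearMap.intervalIntegral_apply
      (Continuous.intervalIntegrable (by fun_prop) _ _)]
  rfl

theorem contDiff_weightedBeam (hφ : Continuous φ) (hw : 0 < w.2) (hh : ContDiff ℝ 1 h)
    (hc : VanishesAbove c h) : ContDiff ℝ 1 (weightedBeam φ w h) := by
  rw [← zero_add 1, contDiff_succ_iff_fderiv_apply]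
  refine ⟨fun x => (hasFDerivAt_weightedBeam hφ hw hh hc x).differentiableAt, by simp, fun v => ?_⟩
  rw [contDiff_zero]
  have hcont := continuous_weightedBeam hφ hw (continuous_Dw hh v) (hc.Dw v)
  rwa [← Dw_weightedBeam hφ hw hh hc v] at hcont

end WeightedBeam

section Beam

variable {c : ℝ} {w : ℝ × ℝ} {g h : ℝ × ℝ → ℝ}

theorem contDiff_Xray (hw : 0 < w.2) (hh : ContDiff ℝ 1 h) (hc : VanishesAbove c h) :
    ContDiff ℝ 1 (Xray w h) :=
  Xray_eq_weightedBeam w h ▸ contDiff_weightedBeam continuous_const hw hh hc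

theorem contDiff_Xray1 (hw : 0 < w.2) (hh : ContDiff ℝ 1 h) (hc : VanishesAbove c h) :
    ContDiff ℝ 1 (Xray1 w h) :=
  contDiff_weightedBeam continuous_id hw hh hc

theorem Dw_Xray (hw : 0 < w.2) (hh : ContDiff ℝ 1 h) (hc : VanishesAbove c h) (v : ℝ × ℝ) :
    Dw v (Xray w h) = Xray w (Dw v h) := by
  rw [Xray_eq_weightedBeam, Xray_eq_weightedBeam, Dw_weightedBeam continuous_const hw hh hc]

theorem Dw_Xray1 (hw : 0 < w.2) (hh : ContDiff ℝ 1 h) (hc : VanishesAbove c h) (v : ℝ × ℝ) :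
    Dw v (Xray1 w h) = Xray1 w (Dw v h) :=
  Dw_weightedBeam continuous_id hw hh hc v

theorem Xray_Dw_self (hh : ContDiff ℝ 1 h) {x : ℝ × ℝ} {T : ℝ}
    (hT : ∀ t, T < t → h (x + t • w) = 0) : Xray w (Dw w h) x = -h x := by
  have hcont := continuous_Dw hh w
  have := setIntegral_Ioi_deriv_eq_neg
    (hasDerivAt_along_ray (hh.differentiable one_ne_zero) w x) (by fun_prop) hT
  simpa [Xray] using this

theorem Dw_Xray_self (hw : 0 < w.2) (hh : ContDiff ℝ 1 h) (hc : VanishesAbove c h) :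
    Dw w (Xray w h) = fun x => -h x := by
  rw [Dw_Xray hw hh hc]
  exact funext fun x => Xray_Dw_self hh fun t ht => hc _ (lt_snd_along_ray hw ht)

theorem Dw_Xray1_self (hw : 0 < w.2) (hh : ContDiff ℝ 1 h) (hc : VanishesAbove c h) :
    Dw w (Xray1 w h) = fun x => -Xray w h x := by
  rw [Dw_Xray1 hw hh hc]
  funext x
  have hcont := continuous_Dw hh w
  have hcont' := hh.continuous
  have hz : ∀ t, (|c| + |x.2|) / w.2 < t → h (x + t • w) = 0 :=
    fun t ht => hc _ (lt_snd_along_ray hw ht)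
  have hparts := setIntegral_Ioi_deriv_eq_neg (T := (|c| + |x.2|) / w.2)
    (fun t => (hasDerivAt_id t).mul
      (hasDerivAt_along_ray (hh.differentiable one_ne_zero) w x t)) (by fun_prop)
    (fun t ht => by simp [hz t ht])
  rw [integral_add] at hparts
  · simp only [id, one_mul, Pi.mul_apply, zero_mul, neg_zero] at hparts
    exact eq_neg_of_add_eq_zero_right hparts
  · exact integrableOn_Ioi_of_eq_zero (T := (|c| + |x.2|) / w.2) (by fun_prop) fun t ht => by simp [hz t ht]
  · refine integrableOn_Ioi_of_eq_zero (T := (|c| + |x.2|) / w.2) (by fun_prop) fun t ht => ?_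
    simp [hc.Dw w _ (lt_snd_along_ray hw ht)]

theorem Xray_sub (hw : 0 < w.2) (hg : Continuous g) (hh : Continuous h)
    (hcg : VanishesAbove c g) (hch : VanishesAbove c h) (x : ℝ × ℝ) :
    Xray w (fun y => g y - h y) x = Xray w g x - Xray w h x :=
  integral_sub
    (integrableOn_Ioi_of_eq_zero (T := (|c| + |x.2|) / w.2) (by fun_prop)
      fun t ht => hcg _ (lt_snd_along_ray hw ht))
    (integrableOn_Ioi_of_eq_zero (T := (|c| + |x.2|) / w.2) (by fun_prop)
      fun t ht => hch _ (lt_snd_along_ray hw ht))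

theorem Xray_const_mul (k : ℝ) (x : ℝ × ℝ) :
    Xray w (fun y => k * h y) x = k * Xray w h x :=
  integral_const_mul k _

end Beam

section VLine

variable {c : ℝ} {u v : ℝ × ℝ} {a b : ℝ × ℝ → ℝ}

theorem Dw_Dw_Xray1_add_Xray1 (hu : 0 < u.2) (hv : 0 < v.2) (ha : ContDiff ℝ 2 a)
    (hb : ContDiff ℝ 2 b) (hca : VanishesAbove c a) (hcb : VanishesAbove c b) (x : ℝ × ℝ) :
    Dw u (Dw v (fun y => Xray1 u a y + Xray1 v b y)) x =
      -Xray u (Dw v a) x - Xray v (Dw u b) x := by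
  have ha1 : ContDiff ℝ 1 a := ha.of_le (by norm_num)
  have hb1 : ContDiff ℝ 1 b := hb.of_le (by norm_num)
  have hinner : Dw v (fun y => Xray1 u a y + Xray1 v b y) =
      fun y => Xray1 u (Dw v a) y + -Xray v b y := by
    funext y
    rw [Dw_add ((contDiff_Xray1 hu ha1 hca).differentiable one_ne_zero)
      ((contDiff_Xray1 hv hb1 hcb).differentiable one_ne_zero),
      Dw_Xray1 hu ha1 hca, Dw_Xray1_self hv hb1 hcb]
  rw [hinner, Dw_add ((contDiff_Xray1 hu (contDiff_Dw ha v) (hca.Dw v)).differentiable one_ne_zero)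
      ((contDiff_Xray hv hb1 hcb).neg.differentiable one_ne_zero), Dw_neg,
      Dw_Xray1_self hu (contDiff_Dw ha v) (hca.Dw v), Dw_Xray hv hb1 hcb, sub_eq_add_neg]

theorem Dw_left_Xray_add_Xray (hu : 0 < u.2) (hv : 0 < v.2) (ha : ContDiff ℝ 1 a)
    (hb : ContDiff ℝ 1 b) (hca : VanishesAbove c a) (hcb : VanishesAbove c b) (x : ℝ × ℝ) :
    Dw u (fun y => Xray u a y + Xray v b y) x = -a x + Xray v (Dw u b) x := by
  rw [Dw_add ((contDiff_Xray hu ha hca).differentiable one_ne_zero)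
    ((contDiff_Xray hv hb hcb).differentiable one_ne_zero),
    Dw_Xray_self hu ha hca, Dw_Xray hv hb hcb]

theorem Dw_right_Xray_add_Xray (hu : 0 < u.2) (hv : 0 < v.2) (ha : ContDiff ℝ 1 a)
    (hb : ContDiff ℝ 1 b) (hca : VanishesAbove c a) (hcb : VanishesAbove c b) (x : ℝ × ℝ) :
    Dw v (fun y => Xray u a y + Xray v b y) x = Xray u (Dw v a) x + -b x := by
  rw [Dw_add ((contDiff_Xray hu ha hca).differentiable one_ne_zero)
    ((contDiff_Xray hv hb hcb).differentiable one_ne_zero),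
    Dw_Xray hu ha hca, Dw_Xray_self hv hb hcb]

theorem Dw_Dw_Xray_Xray_add_Xray {w : ℝ × ℝ} (hw : 0 < w.2) (hu : 0 < u.2) (hv : 0 < v.2)
    (ha : ContDiff ℝ 2 a) (hb : ContDiff ℝ 2 b) (hca : VanishesAbove c a)
    (hcb : VanishesAbove c b) :
    Dw u (Dw v (Xray w (fun y => Xray u a y + Xray v b y))) =
      Xray w (fun y => -Dw v a y + -Dw u b y) := by
  have ha1 : ContDiff ℝ 1 a := ha.of_le (by norm_num)
  have hb1 : ContDiff ℝ 1 b := hb.of_le (by norm_num)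
  have hXa := contDiff_Xray hu (contDiff_Dw ha v) (hca.Dw v)
  have hinner : Dw v (fun y => Xray u a y + Xray v b y) =
      fun y => Xray u (Dw v a) y + -b y :=
    funext (Dw_right_Xray_add_Xray hu hv ha1 hb1 hca hcb)
  rw [Dw_Xray hw ((contDiff_Xray hu ha1 hca).add (contDiff_Xray hv hb1 hcb))
    ((hca.Xray hu).add (hcb.Xray hv)), hinner,
    Dw_Xray hw (hXa.add hb1.neg) (((hca.Dw v).Xray hu).add hcb.neg)]
  congr 1
  funext y
  rw [Dw_add (hXa.differentiable one_ne_zero) (hb1.neg.differentiable one_ne_zero), Dw_neg,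
    Dw_Xray_self hu (contDiff_Dw ha v) (hca.Dw v)]

end VLine

section Disk

variable {h : ℝ × ℝ → ℝ}

theorem eq_zero_of_tsupport_subset_unitDisk (hs : tsupport h ⊆ unitDisk) {x : ℝ × ℝ}
    (hx : 1 ≤ x.1 ^ 2 + x.2 ^ 2) : h x = 0 :=
  image_eq_zero_of_notMem_tsupport fun hmem => absurd (hs hmem) (not_lt.mpr hx)

theorem vanishesAbove_of_tsupport_subset_unitDisk (hs : tsupport h ⊆ unitDisk) :
    VanishesAbove 1 h := fun x hx =>
  eq_zero_of_tsupport_subset_unitDisk hs (by nlinarith [sq_nonneg x.1])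

theorem Xray_vertical_eq_zero (hs : tsupport h ⊆ unitDisk) {x : ℝ × ℝ} (hx : 1 < x.1) :
    Xray (0, 1) h x = 0 := by
  rw [Xray, setIntegral_congr_fun (g := fun _ => 0) measurableSet_Ioi fun t _ => ?_]
  · simp
  · refine eq_zero_of_tsupport_subset_unitDisk hs ?_
    simp
    nlinarith [sq_nonneg (x.2 + t)]

/-- The mixed second derivative of the iterated axis-parallel beam transforms recovers `h`. -/
theorem pdy_Xray_Dw_Xray (hh : ContDiff ℝ 1 h) (hs : tsupport h ⊆ unitDisk) (x : ℝ × ℝ) :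
    pdy (Xray (1, 0) (Dw (1, 0) (Xray (0, 1) h))) x = h x := by
  have hc := vanishesAbove_of_tsupport_subset_unitDisk hs
  have hinner : Xray (1, 0) (Dw (1, 0) (Xray (0, 1) h)) = fun y => -Xray (0, 1) h y := by
    funext y
    refine Xray_Dw_self (T := 1 - y.1) (contDiff_Xray (by simp) hh hc) fun t ht => ?_
    exact Xray_vertical_eq_zero hs (by simp; linarith)
  rw [hinner, pdy, Dw_neg, Dw_Xray_self (by simp) hh hc, neg_neg]

end Disk

theorem contDiff_proj2 {n : WithTop ℕ∞} {f11 f12 f22 : ℝ × ℝ → ℝ} (h11 : ContDiff ℝ n f11)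
    (h12 : ContDiff ℝ n f12) (h22 : ContDiff ℝ n f22) (w : ℝ × ℝ) :
    ContDiff ℝ n (proj2 f11 f12 f22 w) := by
  unfold proj2
  fun_prop

theorem VanishesAbove.proj2 {c : ℝ} {f11 f12 f22 : ℝ × ℝ → ℝ} (h11 : VanishesAbove c f11)
    (h12 : VanishesAbove c f12) (h22 : VanishesAbove c f22) (w : ℝ × ℝ) :
    VanishesAbove c (proj2 f11 f12 f22 w) := fun x hx => by
  simp [_root_.proj2, h11 x hx, h12 x hx, h22 x hx]

theorem stmt_14 (u1 u2 : ℝ) (hu1 : 0 < u1) (hu2 : 0 < u2) (huv : u1 ^ 2 + u2 ^ 2 = 1)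
    (f11 f12 f22 : ℝ × ℝ → ℝ)
    (hf11 : ContDiff ℝ 2 f11) (hf12 : ContDiff ℝ 2 f12) (hf22 : ContDiff ℝ 2 f22)
    (hs11 : tsupport f11 ⊆ unitDisk) (hs12 : tsupport f12 ⊆ unitDisk)
    (hs22 : tsupport f22 ⊆ unitDisk) :
    ∀ x : ℝ × ℝ,
      f12 x =
        (1 / (4 * u1 ^ 2)) *
          pdy (Xray (1, 0) (fun y =>
            Dw (u1, u2) (Dw (-u1, u2) (L1f (u1, u2) (-u1, u2) f11 f12 f22)) y +
              Dw (u1, u2) (Lf (u1, u2) (-u1, u2) f11 f12 f22) y + Dw (-u1, u2) (Lf (u1, u2) (-u1, u2) f11 f12 f22) y +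
              (1 / u2) * Dw (u1, u2) (Dw (-u1, u2) (Xray (0, 1) (Lf (u1, u2) (-u1, u2) f11 f12 f22))) y)) x := by
  intro x
  have hu : 0 < ((u1, u2) : ℝ × ℝ).2 := hu2
  have hv : 0 < ((-u1, u2) : ℝ × ℝ).2 := hu2
  have hc12 := vanishesAbove_of_tsupport_subset_unitDisk hs12
  have hca := (vanishesAbove_of_tsupport_subset_unitDisk hs11).proj2 hc12
    (vanishesAbove_of_tsupport_subset_unitDisk hs22) (u1, u2)
  have hcb := (vanishesAbove_of_tsupport_subset_unitDisk hs11).proj2 hc12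
    (vanishesAbove_of_tsupport_subset_unitDisk hs22) (-u1, u2)
  have ha := contDiff_proj2 hf11 hf12 hf22 (u1, u2)
  have hb := contDiff_proj2 hf11 hf12 hf22 (-u1, u2)
  have hba : ∀ y, proj2 f11 f12 f22 (u1, u2) y =
      proj2 f11 f12 f22 (-u1, u2) y + 4 * u1 * u2 * f12 y := fun y => by
    simp only [proj2]
    ring
  have hL : Lf (u1, u2) (-u1, u2) f11 f12 f22 = fun y =>
      Xray (u1, u2) (proj2 f11 f12 f22 (u1, u2)) y +
        Xray (-u1, u2) (proj2 f11 f12 f22 (-u1, u2)) y := rfl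
  have hL1 : L1f (u1, u2) (-u1, u2) f11 f12 f22 = fun y =>
      Xray1 (u1, u2) (proj2 f11 f12 f22 (u1, u2)) y +
        Xray1 (-u1, u2) (proj2 f11 f12 f22 (-u1, u2)) y := rfl
  rw [hL, hL1]
  generalize proj2 f11 f12 f22 (u1, u2) = a at *
  generalize proj2 f11 f12 f22 (-u1, u2) = b at *
  have ha1 : ContDiff ℝ 1 a := ha.of_le (by norm_num)
  have hb1 : ContDiff ℝ 1 b := hb.of_le (by norm_num)
  have h121 : ContDiff ℝ 1 f12 := hf12.of_le (by norm_num)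
  have hda := ha1.differentiable one_ne_zero
  have hdb := hb1.differentiable one_ne_zero
  have hd12 := h121.differentiable one_ne_zero
  have hsplit : (fun y => -Dw (-u1, u2) a y + -Dw (u1, u2) b y) = fun y =>
      4 * u1 ^ 2 * u2 * Dw (1, 0) f12 y - u2 * Dw (0, 1) (fun z => a z + b z) y := by
    funext y
    have hDa : Dw (1, 0) a y = Dw (1, 0) b y + 4 * u1 * u2 * Dw (1, 0) f12 y := by
      rw [← Dw_const_mul, ← Dw_add hdb (hd12.const_mul _), ← funext hba]
    rw [Dw_eq_linearCombination (-u1, u2) a, Dw_eq_linearCombination (u1, u2) b, hDa,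
      Dw_add hda hdb]
    ring
  have hmain : (fun y =>
      Dw (u1, u2) (Dw (-u1, u2) fun z => Xray1 (u1, u2) a z + Xray1 (-u1, u2) b z) y +
        Dw (u1, u2) (fun z => Xray (u1, u2) a z + Xray (-u1, u2) b z) y +
        Dw (-u1, u2) (fun z => Xray (u1, u2) a z + Xray (-u1, u2) b z) y +
        (1 / u2) * Dw (u1, u2) (Dw (-u1, u2)
          (Xray (0, 1) fun z => Xray (u1, u2) a z + Xray (-u1, u2) b z)) y) =
      fun y => 4 * u1 ^ 2 * Dw (1, 0) (Xray (0, 1) f12) y := by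
    funext y
    have hcab := hca.add hcb
    have hab := ha1.add hb1
    rw [Dw_Dw_Xray1_add_Xray1 hu hv ha hb hca hcb, Dw_left_Xray_add_Xray hu hv ha1 hb1 hca hcb,
      Dw_right_Xray_add_Xray hu hv ha1 hb1 hca hcb,
      Dw_Dw_Xray_Xray_add_Xray (by simp) hu hv ha hb hca hcb, hsplit,
      Xray_sub (by simp) ((continuous_Dw h121 _).const_mul _) ((continuous_Dw hab _).const_mul _)
        ((hc12.Dw _).const_mul _) ((hcab.Dw _).const_mul _),
      Xray_const_mul, Xray_const_mul, Xray_Dw_self hab fun t ht => hcab _ (lt_snd_along_ray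
        (by simp) ht), Dw_Xray (by simp) h121 hc12]
    field_simp
    ring
  have hpull : Xray (1, 0) (fun y => 4 * u1 ^ 2 * Dw (1, 0) (Xray (0, 1) f12) y) = fun y =>
      4 * u1 ^ 2 * Xray (1, 0) (Dw (1, 0) (Xray (0, 1) f12)) y :=
    funext fun y => Xray_const_mul _ y
  rw [hmain, hpull, pdy, Dw_const_mul, ← pdy, pdy_Xray_Dw_Xray h121 hs12]
  field_simp
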